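/- Let X be a finite abstract simplicial complex of dimension d on n vertices with a complete skeleton, and fix α ∈ ℝ. Let ρ_α = ‖(α·I − Δ+)|_{Z_{d-1}}‖ (the maximal absolute value of an eigenvalue of α·I − Δ+ restricted to Z_{d-1}). Then for any pairwise disjoint sets of vertices A_0, …, A_d one has | |F(A_0,…,A_d)| − α·|A_0|·|A_1|⋯|A_d| / n | ≤ ρ_α · (|A_0|·|A_1|⋯|A_d|)^{d/(d+1)}. -/

import Mathlib

open Finset

/-- A finite abstract simplicial complex on the vertex type `V`: a collection of finite
subsets of `V` (the cells), closed under taking subsets and containing the empty cell. -/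
structure SComplex (V : Type) [Fintype V] [DecidableEq V] : Type where
  cells : Finset (Finset V)
  empty_mem : ∅ ∈ cells
  down_closed : ∀ s ∈ cells, ∀ t ⊆ s, t ∈ cells

namespace SComplex

variable {V : Type} [Fintype V] [DecidableEq V]

/-- The cells of `X` with exactly `m` vertices, i.e. the `(m-1)`-dimensional cells `X^{m-1}`. -/
def cellsCard (X : SComplex V) (m : ℕ) : Finset (Finset V) :=
  X.cells.filter fun s => s.card = m

/-- `X` is `D`-dimensional: every cell has at most `D+1` vertices and some cell has
exactly `D+1` vertices. -/
def Dim (X : SComplex V) (D : ℕ) : Prop :=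
  (∀ s ∈ X.cells, s.card ≤ D + 1) ∧ ∃ s ∈ X.cells, s.card = D + 1

/-- `X` (of dimension `D`) has a complete skeleton: every subset of `V` with at most `D`
elements is a cell. -/
def CompleteSkeleton (X : SComplex V) (D : ℕ) : Prop :=
  ∀ s : Finset V, s.card ≤ D → s ∈ X.cells

/-- The set of vertices of an ordered tuple. -/
def tset {m : ℕ} (σ : Fin m → V) : Finset V := Finset.image σ Finset.univ

/-- An ordered tuple of vertices is an oriented cell when it is injective and its vertex
set is a cell of `X`. -/
def IsCell (X : SComplex V) {m : ℕ} (σ : Fin m → V) : Prop :=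
  Function.Injective σ ∧ tset σ ∈ X.cells

instance (X : SComplex V) {m : ℕ} (σ : Fin m → V) : Decidable (X.IsCell σ) := by
  unfold IsCell; infer_instance

/-- `X.nbr v σ` : the vertex `v` does not belong to `σ` and together with `σ` spans a
cell of `X`. -/
def nbr (X : SComplex V) {m : ℕ} (v : V) (σ : Fin m → V) : Prop :=
  v ∉ tset σ ∧ insert v (tset σ) ∈ X.cells

instance (X : SComplex V) {m : ℕ} (v : V) (σ : Fin m → V) : Decidable (X.nbr v σ) := by
  unfold nbr; infer_instance

/-- `f` is an `(m-1)`-form on `X`: a function on ordered tuples of `m` vertices which is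
skew-symmetric with respect to permutations of the tuple, and is supported on the
oriented `(m-1)`-cells of `X`. -/
def IsForm (X : SComplex V) (m : ℕ) (f : (Fin m → V) → ℝ) : Prop :=
  (∀ (σ : Fin m → V) (π : Equiv.Perm (Fin m)),
      f (σ ∘ π) = ((Equiv.Perm.sign π : ℤ) : ℝ) * f σ) ∧
  ∀ σ : Fin m → V, ¬ X.IsCell σ → f σ = 0

/-- The space `Ω^{m-1}(X)` of `(m-1)`-forms, as a submodule of the functions on tuples. -/
def formSub (X : SComplex V) (m : ℕ) : Submodule ℝ ((Fin m → V) → ℝ) where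
  carrier := {f | X.IsForm m f}
  add_mem' := @fun f g hf hg => ⟨fun σ π => by
      simp only [Pi.add_apply, hf.1 σ π, hg.1 σ π]; ring,
    fun σ h => by simp only [Pi.add_apply, hf.2 σ h, hg.2 σ h, add_zero]⟩
  zero_mem' := ⟨fun σ π => by simp, fun σ h => rfl⟩
  smul_mem' := @fun c f hf => ⟨fun σ π => by
      simp only [Pi.smul_apply, smul_eq_mul, hf.1 σ π]; ring,
    fun σ h => by simp only [Pi.smul_apply, hf.2 σ h, smul_eq_mul, mul_zero]⟩

/-- The inner product `⟨f,g⟩ = ∑_{σ ∈ X^{m-1}} f(σ) g(σ)` on `(m-1)`-forms, computed via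
ordered tuples (each cell is counted `m!` times, once for each ordering of its vertices). -/
noncomputable def innerForm (m : ℕ) (f g : (Fin m → V) → ℝ) : ℝ :=
  ((m.factorial : ℝ))⁻¹ * ∑ σ : Fin m → V, f σ * g σ

/-- The boundary operator `∂ : Ω^m → Ω^{m-1}`, `(∂f)(σ) = ∑_{v ∼ σ} f(vσ)`. -/
def bdry (X : SComplex V) (m : ℕ) (f : (Fin (m+1) → V) → ℝ) : (Fin m → V) → ℝ :=
  fun σ => ∑ v : V, if X.nbr v σ then f (Fin.cons v σ) else 0

/-- The coboundary operator `∂* : Ω^{m-1} → Ω^m`, `(∂*f)(σ) = ∑ i (-1)^i f(σ ∖ σᵢ)`,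
supported on the oriented `m`-cells of `X`. -/
def cobdry (X : SComplex V) (m : ℕ) (f : (Fin m → V) → ℝ) : (Fin (m+1) → V) → ℝ :=
  fun σ => if X.IsCell σ then ∑ i : Fin (m+1), (-1 : ℝ) ^ (i : ℕ) * f (σ ∘ i.succAbove) else 0

/-- The upper Laplacian `Δ⁺ = ∂ ∘ ∂*` on `(m-1)`-forms. -/
def upLap (X : SComplex V) (m : ℕ) (f : (Fin m → V) → ℝ) : (Fin m → V) → ℝ :=
  X.bdry m (X.cobdry m f)

/-- The lower Laplacian `Δ⁻ = ∂* ∘ ∂` on `m`-forms. -/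
def lowLap (X : SComplex V) (m : ℕ) (f : (Fin (m+1) → V) → ℝ) : (Fin (m+1) → V) → ℝ :=
  X.cobdry m (X.bdry m f)

/-- The boundary operator as a linear map. -/
def bdryL (X : SComplex V) (m : ℕ) : ((Fin (m+1) → V) → ℝ) →ₗ[ℝ] ((Fin m → V) → ℝ) where
  toFun := X.bdry m
  map_add' f g := by
    funext σ
    show (∑ v : V, if X.nbr v σ then (f + g) (Fin.cons v σ) else 0) =
      (∑ v : V, if X.nbr v σ then f (Fin.cons v σ) else 0) +
      (∑ v : V, if X.nbr v σ then g (Fin.cons v σ) else 0)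
    rw [← Finset.sum_add_distrib]
    exact Finset.sum_congr rfl fun v _ => by by_cases h : X.nbr v σ <;> simp [h]
  map_smul' c f := by
    funext σ
    show (∑ v : V, if X.nbr v σ then (c • f) (Fin.cons v σ) else 0) =
      c * (∑ v : V, if X.nbr v σ then f (Fin.cons v σ) else 0)
    rw [Finset.mul_sum]
    exact Finset.sum_congr rfl fun v _ => by by_cases h : X.nbr v σ <;> simp [h]

/-- The coboundary operator as a linear map. -/
def cobdryL (X : SComplex V) (m : ℕ) : ((Fin m → V) → ℝ) →ₗ[ℝ] ((Fin (m+1) → V) → ℝ) where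
  toFun := X.cobdry m
  map_add' f g := by
    funext σ
    show X.cobdry m (f + g) σ = X.cobdry m f σ + X.cobdry m g σ
    unfold cobdry
    by_cases h : X.IsCell σ
    · simp only [h, if_true, ← Finset.sum_add_distrib]
      exact Finset.sum_congr rfl fun i _ => by simp [Pi.add_apply]; ring
    · simp [h]
  map_smul' c f := by
    funext σ
    show X.cobdry m (c • f) σ = c * X.cobdry m f σ
    unfold cobdry
    by_cases h : X.IsCell σ
    · simp only [h, if_true, Finset.mul_sum]
      exact Finset.sum_congr rfl fun i _ => by simp [Pi.smul_apply]; ring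
    · simp [h]

/-- The degree of a cell `s`: the number of cells with one more vertex containing `s`. -/
def degCell (X : SComplex V) (s : Finset V) : ℕ :=
  (X.cells.filter fun t => s ⊆ t ∧ t.card = s.card + 1).card

/-- The maximal degree of an `(m-1)`-cell of `X`. -/
def maxDeg (X : SComplex V) (m : ℕ) : ℕ :=
  (X.cellsCard m).sup fun s => X.degCell s

/-- The spectrum of the upper Laplacian of a `(d+1)`-dimensional complex restricted to
the cycle space `Z = ker ∂` inside the space of forms on `d+1` vertices. -/
def specUpLapZ (X : SComplex V) (d : ℕ) : Set ℝ :=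
  {μ | ∃ f : (Fin (d+1) → V) → ℝ,
    X.IsForm (d+1) f ∧ X.bdry d f = 0 ∧ f ≠ 0 ∧ X.upLap (d+1) f = μ • f}

/-- The spectral gap `λ(X) = min Spec (Δ⁺|_Z)` of a `(d+1)`-dimensional complex. -/
noncomputable def spectralGap (X : SComplex V) (d : ℕ) : ℝ :=
  sInf (X.specUpLapZ d)

/-- `F(A 0, …, A (m-1))`: the set of cells with `m` vertices having exactly one vertex
in each `A i`. -/
def Fcells (X : SComplex V) {m : ℕ} (A : Fin m → Finset V) : Finset (Finset V) :=
  X.cells.filter fun s => s.card = m ∧ ∀ i, (s ∩ A i).card = 1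

/-- The Cheeger constant of a `(d+1)`-dimensional complex: the minimum over all
partitions of the vertex set into `d+2` nonempty parts of `n·|F(A₀,…)|/∏|Aᵢ|`. -/
noncomputable def cheeger (X : SComplex V) (d : ℕ) : ℝ :=
  sInf { r : ℝ | ∃ A : Fin (d+2) → Finset V,
    (∀ i, (A i).Nonempty) ∧ (∀ i j, i ≠ j → Disjoint (A i) (A j)) ∧
    Finset.univ.biUnion A = Finset.univ ∧
    r = (Fintype.card V : ℝ) * ((X.Fcells A).card : ℝ) / ∏ i, ((A i).card : ℝ) }

/-- The `m`-th reduced Betti number `β_m = dim H_m` of `X` over `ℝ`: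
`dim (Ω^m ∩ ker ∂_m) - dim (∂_{m+1} Ω^{m+1})`. -/
noncomputable def betti (X : SComplex V) (m : ℕ) : ℕ :=
  Module.finrank ℝ ↥(X.formSub (m+1) ⊓ LinearMap.ker (X.bdryL m)) -
  Module.finrank ℝ ↥(Submodule.map (X.bdryL (m+1)) (X.formSub (m+2)))

/-- The vertices of the link of `τ`. -/
def linkVerts (X : SComplex V) (τ : Finset V) : Finset V :=
  Finset.univ.filter fun v => v ∉ τ ∧ insert v τ ∈ X.cells

/-- The neighbours of `v` in the link graph of `τ`. -/
def linkNbrs (X : SComplex V) (τ : Finset V) (v : V) : Finset V :=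
  Finset.univ.filter fun w => w ≠ v ∧ w ∉ τ ∧ v ∉ τ ∧ insert v (insert w τ) ∈ X.cells

/-- The graph Laplacian of the link of `τ`. -/
def linkLap (X : SComplex V) (τ : Finset V) (g : V → ℝ) : V → ℝ :=
  fun v => ((X.linkNbrs τ v).card : ℝ) * g v - ∑ w ∈ X.linkNbrs τ v, g w

/-- The graph spectral gap of the link of `τ`: the minimal eigenvalue of its graph
Laplacian on functions on its vertices summing to zero. -/
noncomputable def linkGap (X : SComplex V) (τ : Finset V) : ℝ :=
  sInf {μ : ℝ | ∃ g : V → ℝ, (∀ v, v ∉ X.linkVerts τ → g v = 0) ∧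
    (∑ v ∈ X.linkVerts τ, g v = 0) ∧ g ≠ 0 ∧
    ∀ v ∈ X.linkVerts τ, X.linkLap τ g v = μ * g v}

/-- The graph Cheeger constant of the link of `τ`: the minimum over partitions
`B ⊔ C` of its vertex set of `|W|·|E(B,C)|/(|B|·|C|)`. -/
noncomputable def linkCheeger (X : SComplex V) (τ : Finset V) : ℝ :=
  sInf { r : ℝ | ∃ B C : Finset V, B.Nonempty ∧ C.Nonempty ∧ Disjoint B C ∧
    B ∪ C = X.linkVerts τ ∧
    r = ((X.linkVerts τ).card : ℝ) *
        (((B ×ˢ C).filter fun p => insert p.1 (insert p.2 τ) ∈ X.cells).card : ℝ) /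
        ((B.card : ℝ) * (C.card : ℝ)) }

/-- `deg_τ(s)`: the number of neighbours `s'` of the cell `s` which contain `τ` (two
distinct cells with the same number of vertices are neighbours when their union is a
cell of `X` with one more vertex). -/
def degTau (X : SComplex V) (τ s : Finset V) : ℕ :=
  (X.cells.filter fun s' => s'.card = s.card ∧ s' ≠ s ∧ τ ⊆ s' ∧
    (s ∪ s').card = s.card + 1 ∧ s ∪ s' ∈ X.cells).card

/-- The local upper Laplacian `Δ⁺_τ` associated to a cell `τ` with `d` vertices of a
`(d+1)`-dimensional complex, acting on forms on `d+1` vertices: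
`(Δ⁺_τ f)(σ) = deg_τ(σ) f(σ) - ∑_{σ' ∼ σ, τ ⊆ σ'} f(σ')` when `τ ⊆ σ`, and `0` else. -/
def localUpLap (X : SComplex V) (d : ℕ) (τ : Finset V) (f : (Fin (d+1) → V) → ℝ) :
    (Fin (d+1) → V) → ℝ :=
  fun σ => if τ ⊆ tset σ then
      (X.degTau τ (tset σ) : ℝ) * f σ -
        ∑ v : V, if X.nbr v σ then
          ∑ i : Fin (d+1), if σ i ∉ τ then
            (-1 : ℝ) ^ (i : ℕ) * f (Fin.cons v σ ∘ Fin.succAbove i.succ) else 0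
        else 0
    else 0

/-- The complement complex `X̄` of a `D`-dimensional complex `X` with complete skeleton:
it has the same cells of dimension `< D`, and its `D`-dimensional cells are exactly the
vertex sets of size `D+1` which are not cells of `X`. -/
def complComplex (X : SComplex V) (D : ℕ) (hX : X.CompleteSkeleton D) : SComplex V where
  cells := (X.cells.filter fun s => s.card ≤ D) ∪
    ((Finset.univ : Finset V).powersetCard (D+1)).filter fun s => s ∉ X.cells
  empty_mem := Finset.mem_union_left _ (Finset.mem_filter.mpr ⟨X.empty_mem, by simp⟩)
  down_closed := by
    intro s hs t ht
    rcases Finset.mem_union.mp hs with h | h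
    · rw [Finset.mem_filter] at h
      exact Finset.mem_union_left _ (Finset.mem_filter.mpr
        ⟨X.down_closed s h.1 t ht, le_trans (Finset.card_le_card ht) h.2⟩)
    · rw [Finset.mem_filter, Finset.mem_powersetCard] at h
      by_cases hts : t = s
      · subst hts
        exact Finset.mem_union_right _ (Finset.mem_filter.mpr
          ⟨Finset.mem_powersetCard.mpr h.1, h.2⟩)
      · have hlt : t.card < s.card := Finset.card_lt_card (ht.ssubset_of_ne hts)
        have hsD : s.card = D + 1 := h.1.2
        have htD : t.card ≤ D := by omega
        exact Finset.mem_union_left _ (Finset.mem_filter.mpr ⟨hX t htD, htD⟩)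

/-- The simplicial complex on `V` with complete `(d+1)`-dimensional skeleton whose
top-dimensional cells (with `d+2` vertices) are the members of `T`: the Linial–Meshulam
complex determined by the sample `T`. -/
def lmComplex (V : Type) [Fintype V] [DecidableEq V] (d : ℕ) (T : Finset (Finset V)) :
    SComplex V where
  cells := (Finset.univ.powerset.filter fun s : Finset V => s.card ≤ d + 1) ∪
    T.filter fun s => s.card = d + 2
  empty_mem := Finset.mem_union_left _ (by simp)
  down_closed := by
    intro s hs t ht
    rcases Finset.mem_union.mp hs with h | h
    · rw [Finset.mem_filter] at h
      exact Finset.mem_union_left _ (Finset.mem_filter.mpr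
        ⟨Finset.mem_powerset.mpr (Finset.subset_univ t), le_trans (Finset.card_le_card ht) h.2⟩)
    · rw [Finset.mem_filter] at h
      by_cases hts : t = s
      · subst hts; exact Finset.mem_union_right _ (Finset.mem_filter.mpr h)
      · have hlt : t.card < s.card := Finset.card_lt_card (ht.ssubset_of_ne hts)
        have hsd : s.card = d + 2 := h.2
        have htd : t.card ≤ d + 1 := by omega
        exact Finset.mem_union_left _ (Finset.mem_filter.mpr
          ⟨Finset.mem_powerset.mpr (Finset.subset_univ t), htd⟩)

open Classical in
/-- The probability, under the Linial–Meshulam measure `X(d+1, n, p)` (each possible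
top-dimensional cell on `d+2` vertices is included independently with probability `p`),
of an event `E` depending on the set of top-dimensional cells. -/
noncomputable def lmProb (V : Type) [Fintype V] [DecidableEq V] (d : ℕ) (p : ℝ)
    (E : Finset (Finset V) → Prop) : ℝ :=
  ∑ T ∈ ((Finset.univ : Finset V).powersetCard (d+2)).powerset,
    if E T then
      p ^ T.card * (1 - p) ^ (((Finset.univ : Finset V).powersetCard (d+2)).card - T.card)
    else 0

end SComplex

namespace SComplex

variable {V : Type} {m : ℕ}

/-- Skew-symmetry of a function on ordered tuples. -/
def IsSkew (f : (Fin m → V) → ℝ) : Prop :=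
  ∀ (σ : Fin m → V) (π : Equiv.Perm (Fin m)),
    f (σ ∘ π) = ((Equiv.Perm.sign π : ℤ) : ℝ) * f σ

lemma sign_mul_sign (π : Equiv.Perm (Fin m)) :
    ((Equiv.Perm.sign π : ℤ) : ℝ) * ((Equiv.Perm.sign π : ℤ) : ℝ) = 1 := by
  rcases Int.units_eq_one_or (Equiv.Perm.sign π) with h | h <;> simp [h]

lemma IsSkew.eq_zero_of_not_injective {f : (Fin m → V) → ℝ} (hf : IsSkew f)
    {σ : Fin m → V} (hσ : ¬ Function.Injective σ) : f σ = 0 := by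
  simp only [Function.Injective, not_forall] at hσ
  obtain ⟨i, j, hij, hne⟩ := hσ
  have hswap : σ ∘ Equiv.swap i j = σ := by
    funext k
    by_cases hki : k = i
    · simp [hki, hij]
    · by_cases hkj : k = j
      · simp [hkj, hij]
      · simp [Equiv.swap_apply_of_ne_of_ne hki hkj]
  have h := hf σ (Equiv.swap i j)
  rw [hswap, Equiv.Perm.sign_swap hne] at h
  push_cast at h
  linarith

/-- The faces of a tuple, in terms of the tuple permuted by a cycle. -/
lemma comp_succAbove_eq (τ : Fin (m + 1) → V) (i : Fin (m + 1)) :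
    τ ∘ i.succAbove = (τ ∘ i.cycleRange.symm) ∘ Fin.succ := by
  funext j
  simp [Fin.cycleRange_symm_succ]

lemma sign_cycleRange_symm (i : Fin (m + 1)) :
    ((Equiv.Perm.sign i.cycleRange.symm : ℤ) : ℝ) = (-1) ^ (i : ℕ) := by
  simp [Fin.sign_cycleRange]

/-- A permutation fixing `0` acts on the tail of a tuple with the same sign. -/
lemma IsSkew.apply_tail_of_fix {f : (Fin m → V) → ℝ} (hf : IsSkew f) (τ : Fin (m + 1) → V)
    (e : Equiv.Perm (Fin (m + 1))) (he : e 0 = 0) :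
    f ((τ ∘ e) ∘ Fin.succ) = ((Equiv.Perm.sign e : ℤ) : ℝ) * f (τ ∘ Fin.succ) := by
  obtain ⟨⟨p, e'⟩, rfl⟩ := Equiv.Perm.decomposeFin.symm.surjective e
  rw [Equiv.Perm.decomposeFin_symm_apply_zero] at he
  subst he
  have h : (τ ∘ Equiv.Perm.decomposeFin.symm (0, e')) ∘ Fin.succ = (τ ∘ Fin.succ) ∘ e' := by
    funext j
    simp
  rw [h, hf, Equiv.Perm.decomposeFin.symm_sign]
  simp

lemma IsSkew.sign_mul_tail_congr {f : (Fin m → V) → ℝ} (hf : IsSkew f) (τ : Fin (m + 1) → V)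
    (c c' : Equiv.Perm (Fin (m + 1))) (h : c 0 = c' 0) :
    ((Equiv.Perm.sign c : ℤ) : ℝ) * f ((τ ∘ c) ∘ Fin.succ) =
      ((Equiv.Perm.sign c' : ℤ) : ℝ) * f ((τ ∘ c') ∘ Fin.succ) := by
  have hfix : (c'⁻¹ * c) 0 = 0 := by simp [h]
  have hc : τ ∘ c = (τ ∘ c') ∘ (c'⁻¹ * c : Equiv.Perm (Fin (m + 1))) := by
    funext j
    simp
  rw [hc, hf.apply_tail_of_fix _ _ hfix, ← mul_assoc]
  congr 1
  have h1 := sign_mul_sign c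
  simp only [Equiv.Perm.sign_mul, Equiv.Perm.sign_inv, Units.val_mul, Int.cast_mul]
  linear_combination ((Equiv.Perm.sign c' : ℤ) : ℝ) * h1

/-- The alternating sum over the faces of a tuple is skew-symmetric. -/
lemma IsSkew.alternatingSum {f : (Fin m → V) → ℝ} (hf : IsSkew f) :
    IsSkew fun τ : Fin (m + 1) → V =>
      ∑ i : Fin (m + 1), (-1 : ℝ) ^ (i : ℕ) * f (τ ∘ i.succAbove) := by
  intro τ π
  simp only [comp_succAbove_eq, ← sign_cycleRange_symm]
  rw [Finset.mul_sum, eq_comm, ← Equiv.sum_comp π]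
  refine Finset.sum_congr rfl fun i _ => ?_
  rw [← hf.sign_mul_tail_congr τ (π * i.cycleRange.symm) (π i).cycleRange.symm (by simp),
    Equiv.Perm.sign_mul, Equiv.Perm.coe_mul, ← Function.comp_assoc τ]
  push_cast
  linear_combination ((Equiv.Perm.sign i.cycleRange.symm : ℤ) : ℝ) *
    f (((τ ∘ π) ∘ i.cycleRange.symm) ∘ Fin.succ) * sign_mul_sign π

lemma sum_cons [Fintype V] (F : (Fin (m + 1) → V) → ℝ) :
    ∑ σ : Fin m → V, ∑ v : V, F (Fin.cons v σ) = ∑ τ, F τ := by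
  rw [Finset.sum_comm, ← Fintype.sum_prod_type']
  exact Equiv.sum_comp (Fin.consEquiv fun _ => V) F

/-- Against a skew-symmetric function, all faces of a tuple contribute equally. -/
lemma IsSkew.sum_alternatingSum_mul [Fintype V] {f : (Fin m → V) → ℝ}
    {h : (Fin (m + 1) → V) → ℝ} (hh : IsSkew h) :
    ∑ τ, (∑ i : Fin (m + 1), (-1 : ℝ) ^ (i : ℕ) * f (τ ∘ i.succAbove)) * h τ =
      ((m : ℝ) + 1) * ∑ τ, f (τ ∘ Fin.succ) * h τ := by
  simp only [Finset.sum_mul]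
  rw [Finset.sum_comm]
  have key : ∀ i : Fin (m + 1),
      ∑ τ, (-1 : ℝ) ^ (i : ℕ) * f (τ ∘ i.succAbove) * h τ = ∑ τ, f (τ ∘ Fin.succ) * h τ := by
    intro i
    rw [← Equiv.sum_comp (Equiv.arrowCongr i.cycleRange (Equiv.refl V))
      fun τ => f (τ ∘ Fin.succ) * h τ]
    refine Finset.sum_congr rfl fun τ _ => ?_
    have hτ : Equiv.arrowCongr i.cycleRange (Equiv.refl V) τ = τ ∘ i.cycleRange.symm := rfl
    rw [hτ, hh τ i.cycleRange.symm, sign_cycleRange_symm, comp_succAbove_eq]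
    ring
  rw [Finset.sum_congr rfl fun i _ => key i]
  simp

variable [DecidableEq V]

lemma tset_comp_perm (σ : Fin m → V) (π : Equiv.Perm (Fin m)) : tset (σ ∘ π) = tset σ := by
  ext v
  simp only [tset, Finset.mem_image, Finset.mem_univ, true_and, Function.comp_apply]
  exact π.exists_congr_left.trans (by simp)

lemma tset_cons (v : V) (σ : Fin m → V) :
    tset (Fin.cons v σ : Fin (m + 1) → V) = insert v (tset σ) := by
  ext w
  simp [tset, Fin.exists_fin_succ, eq_comm]

variable [Fintype V]

lemma isCell_comp_perm (X : SComplex V) (σ : Fin m → V) (π : Equiv.Perm (Fin m)) :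
    X.IsCell (σ ∘ π) ↔ X.IsCell σ := by
  simp [IsCell, tset_comp_perm]

lemma nbr_of_isCell_cons {X : SComplex V} {v : V} {σ : Fin m → V}
    (h : X.IsCell (Fin.cons v σ : Fin (m + 1) → V)) : X.nbr v σ := by
  obtain ⟨hinj, hmem⟩ := h
  rw [Fin.cons_injective_iff] at hinj
  rw [tset_cons] at hmem
  refine ⟨?_, hmem⟩
  simpa [tset] using hinj.1

lemma IsForm.bdry_apply {X : SComplex V} {f : (Fin (m + 1) → V) → ℝ} (hf : X.IsForm (m + 1) f)
    (σ : Fin m → V) : X.bdry m f σ = ∑ v, f (Fin.cons v σ) := by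
  refine Finset.sum_congr rfl fun v _ => ?_
  split_ifs with h
  · rfl
  · exact (hf.2 _ fun hc => h (nbr_of_isCell_cons hc)).symm

lemma IsForm.isSkew_bdry {X : SComplex V} {f : (Fin (m + 1) → V) → ℝ}
    (hf : X.IsForm (m + 1) f) : IsSkew (X.bdry m f) := by
  intro σ π
  rw [hf.bdry_apply, hf.bdry_apply, Finset.mul_sum]
  refine Finset.sum_congr rfl fun v _ => ?_
  have h : (Fin.cons v (σ ∘ π) : Fin (m + 1) → V) =
      Fin.cons v σ ∘ Equiv.Perm.decomposeFin.symm (0, π) := by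
    funext j
    refine Fin.cases ?_ (fun j => ?_) j <;> simp
  rw [h, hf.1, Equiv.Perm.decomposeFin.symm_sign]
  simp

lemma IsForm.bdry_bdry {X : SComplex V} {f : (Fin (m + 2) → V) → ℝ}
    (hf : X.IsForm (m + 2) f) (hbf : X.IsForm (m + 1) (X.bdry (m + 1) f)) :
    X.bdry m (X.bdry (m + 1) f) = 0 := by
  funext σ
  rw [hbf.bdry_apply]
  simp only [hf.bdry_apply, Pi.zero_apply]
  have hswap : ∀ v w : V, f (Fin.cons w (Fin.cons v σ : Fin (m + 1) → V)) =
      - f (Fin.cons v (Fin.cons w σ : Fin (m + 1) → V)) := by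
    intro v w
    have h : (Fin.cons w (Fin.cons v σ : Fin (m + 1) → V) : Fin (m + 2) → V) =
        Fin.cons v (Fin.cons w σ : Fin (m + 1) → V) ∘ Equiv.swap 0 (Fin.succ 0) := by
      funext j
      refine Fin.cases ?_ (fun j => Fin.cases ?_ (fun j => ?_) j) j
      · rw [Function.comp_apply, Equiv.swap_apply_left, Fin.cons_succ]
        rfl
      · rw [Function.comp_apply, Equiv.swap_apply_right, Fin.cons_succ]
        rfl
      · have h1 : j.succ.succ ≠ Fin.succ (0 : Fin (m + 1)) :=
          fun h => Fin.succ_ne_zero j (Fin.succ_injective _ h)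
        rw [Function.comp_apply, Equiv.swap_apply_of_ne_of_ne (Fin.succ_ne_zero _) h1]
        rfl
    rw [h, hf.1, Equiv.Perm.sign_swap (Fin.succ_ne_zero 0).symm]
    simp
  have h1 : ∑ v, ∑ w, f (Fin.cons w (Fin.cons v σ : Fin (m + 1) → V)) =
      - ∑ v, ∑ w, f (Fin.cons w (Fin.cons v σ : Fin (m + 1) → V)) := by
    conv_lhs => rw [Finset.sum_comm]
    simp only [← Finset.sum_neg_distrib, ← hswap]
  linarith

lemma IsSkew.isForm_cobdry (X : SComplex V) {f : (Fin m → V) → ℝ} (hf : IsSkew f) :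
    X.IsForm (m + 1) (X.cobdry m f) := by
  refine ⟨fun τ π => ?_, fun τ h => if_neg h⟩
  by_cases h : X.IsCell τ
  · simp only [cobdry, if_pos h, if_pos ((isCell_comp_perm X τ π).2 h)]
    exact hf.alternatingSum τ π
  · simp [cobdry, h, isCell_comp_perm]

lemma IsForm.sum_mul_bdry {X : SComplex V} {f : (Fin m → V) → ℝ} {h : (Fin (m + 1) → V) → ℝ}
    (hh : X.IsForm (m + 1) h) :
    ∑ σ, f σ * X.bdry m h σ = ∑ τ, f (τ ∘ Fin.succ) * h τ := by
  simp only [hh.bdry_apply, ← sum_cons fun τ => f (τ ∘ Fin.succ) * h τ, Finset.mul_sum]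
  rfl

lemma IsSkew.sum_mul_upLap (X : SComplex V) (f : (Fin m → V) → ℝ) {g : (Fin m → V) → ℝ}
    (hg : IsSkew g) :
    ((m : ℝ) + 1) * ∑ σ, f σ * X.upLap m g σ = ∑ τ, X.cobdry m f τ * X.cobdry m g τ := by
  have hform := hg.isForm_cobdry X
  rw [upLap, hform.sum_mul_bdry, ← IsSkew.sum_alternatingSum_mul hform.1]
  refine Finset.sum_congr rfl fun τ _ => ?_
  by_cases h : X.IsCell τ
  · simp only [cobdry, if_pos h]
  · simp [hform.2 τ h]

lemma IsSkew.sum_mul_upLap_comm (X : SComplex V) {f g : (Fin m → V) → ℝ}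
    (hf : IsSkew f) (hg : IsSkew g) :
    ∑ σ, f σ * X.upLap m g σ = ∑ σ, X.upLap m f σ * g σ := by
  have h1 := hg.sum_mul_upLap X f
  have h2 := hf.sum_mul_upLap X g
  simp only [mul_comm (X.cobdry m g _)] at h2
  simp only [mul_comm (X.upLap m f _)]
  rw [← h2] at h1
  exact mul_left_cancel₀ (by positivity) h1

lemma CompleteSkeleton.isForm {X : SComplex V} (hX : X.CompleteSkeleton m)
    {f : (Fin m → V) → ℝ} (hf : IsSkew f) : X.IsForm m f := by
  refine ⟨hf, fun σ h => ?_⟩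
  by_cases hσ : Function.Injective σ
  · refine absurd ⟨hσ, hX _ ?_⟩ h
    exact Finset.card_image_le.trans (by simp)
  · exact hf.eq_zero_of_not_injective hσ

lemma IsSkew.isSkew_upLap (X : SComplex V) {f : (Fin m → V) → ℝ} (hf : IsSkew f) :
    IsSkew (X.upLap m f) :=
  (hf.isForm_cobdry X).isSkew_bdry

lemma CompleteSkeleton.bdry_upLap {X : SComplex V} (hX : X.CompleteSkeleton (m + 1))
    {f : (Fin (m + 1) → V) → ℝ} (hf : IsSkew f) : X.bdry m (X.upLap (m + 1) f) = 0 :=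
  (hf.isForm_cobdry X).bdry_bdry (hX.isForm (hf.isSkew_upLap X))

variable (V) in
/-- The full simplex on `V`. -/
def fullComplex : SComplex V where
  cells := Finset.univ
  empty_mem := Finset.mem_univ _
  down_closed := fun _ _ _ _ => Finset.mem_univ _

lemma completeSkeleton_fullComplex (D : ℕ) : (fullComplex V).CompleteSkeleton D :=
  fun _ _ => Finset.mem_univ _

/-- On cycles, the upper Laplacian of the full simplex is multiplication by `|V|`. -/
lemma upLap_fullComplex_of_cycle {f : (Fin (m + 1) → V) → ℝ} (hf : IsSkew f)
    (hZ : ∀ σ : Fin m → V, ∑ v, f (Fin.cons v σ) = 0) (σ : Fin (m + 1) → V) :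
    (fullComplex V).upLap (m + 1) f σ = (Fintype.card V : ℝ) * f σ := by
  have hcob : ∀ τ, (fullComplex V).cobdry (m + 1) f τ =
      ∑ i : Fin (m + 2), (-1 : ℝ) ^ (i : ℕ) * f (τ ∘ i.succAbove) := by
    intro τ
    by_cases h : Function.Injective τ
    · exact if_pos ⟨h, Finset.mem_univ _⟩
    · rw [hf.alternatingSum.eq_zero_of_not_injective h]
      exact if_neg fun hc => h hc.1
  rw [upLap, (hf.isForm_cobdry _).bdry_apply]
  have hface : ∀ v : V, (fullComplex V).cobdry (m + 1) f (Fin.cons v σ) =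
      f σ - ∑ i : Fin (m + 1), (-1 : ℝ) ^ (i : ℕ) * f (Fin.cons v (σ ∘ i.succAbove)) := by
    intro v
    rw [hcob, Fin.sum_univ_succ, sub_eq_add_neg, ← Finset.sum_neg_distrib]
    congr 1
    · simp [Function.comp_def]
    · refine Finset.sum_congr rfl fun i _ => ?_
      have h : i.removeNth σ = σ ∘ i.succAbove := rfl
      rw [Fin.cons_comp_succ_succAbove, Fin.val_succ, pow_succ, h]
      ring
  simp only [hface, Finset.sum_sub_distrib]
  rw [Finset.sum_comm]
  simp [← Finset.mul_sum, hZ]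

end SComplex

namespace SComplex

variable {V : Type} {m : ℕ}

lemma injective_of_forall_mem {A : Fin m → Finset V}
    (hA : ∀ i j, i ≠ j → Disjoint (A i) (A j)) {τ : Fin m → V} (h : ∀ i, τ i ∈ A i) :
    Function.Injective τ := by
  intro i j hij
  by_contra hne
  exact Finset.disjoint_left.1 (hA i j hne) (h i) (hij ▸ h j)

variable [DecidableEq V]

/-- The skew-symmetric function which is supported on the tuples with one vertex in each `B i`,
with value the sign of the permutation sorting the tuple. -/
def boxForm (B : Fin m → Finset V) (σ : Fin m → V) : ℝ :=
  Matrix.det (Matrix.of fun i j => if σ j ∈ B i then (1 : ℝ) else 0)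

lemma isSkew_boxForm (B : Fin m → Finset V) : IsSkew (boxForm B) :=
  fun σ π => Matrix.det_permute' π (Matrix.of fun i j => if σ j ∈ B i then (1 : ℝ) else 0)

lemma boxForm_eq_zero_of_col {B : Fin m → Finset V} {σ : Fin m → V} (j : Fin m)
    (h : ∀ i, σ j ∉ B i) : boxForm B σ = 0 :=
  Matrix.det_eq_zero_of_column_eq_zero j fun i => by simp [h i]

lemma boxForm_eq_zero_of_row {B : Fin m → Finset V} {σ : Fin m → V} (i : Fin m)
    (h : ∀ j, σ j ∉ B i) : boxForm B σ = 0 :=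
  Matrix.det_eq_zero_of_row_eq_zero i fun j => by simp [h j]

lemma boxForm_eq_one {B : Fin m → Finset V} (hB : ∀ i j, i ≠ j → Disjoint (B i) (B j))
    {σ : Fin m → V} (h : ∀ i, σ i ∈ B i) : boxForm B σ = 1 := by
  have h1 : (Matrix.of fun i j => if σ j ∈ B i then (1 : ℝ) else 0) = 1 := by
    ext i j
    by_cases hij : i = j
    · subst hij
      simp [h i]
    · simp [Matrix.one_apply_ne hij, Finset.disjoint_right.1 (hB i j hij) (h j)]
  rw [boxForm, h1, Matrix.det_one]

variable [Fintype V]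

lemma sum_boxForm_mul (B : Fin m → Finset V) {h : (Fin m → V) → ℝ} (hh : IsSkew h) :
    ∑ σ, boxForm B σ * h σ = (m.factorial : ℝ) * ∑ σ ∈ Fintype.piFinset B, h σ := by
  have key : ∀ π : Equiv.Perm (Fin m),
      ∑ σ : Fin m → V, ((Equiv.Perm.sign π : ℤ) : ℝ) *
        (∏ i, if σ i ∈ B (π i) then (1 : ℝ) else 0) * h σ =
      ∑ σ ∈ Fintype.piFinset B, h σ := by
    intro π
    rw [← Equiv.sum_comp (Equiv.arrowCongr π.symm (Equiv.refl V)),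
      ← Finset.sum_filter_add_sum_filter_not Finset.univ (· ∈ Fintype.piFinset B)]
    have hτ : ∀ τ, Equiv.arrowCongr π.symm (Equiv.refl V) τ = τ ∘ π := fun _ => rfl
    simp only [hτ, Function.comp_apply, hh _ π]
    rw [Finset.filter_mem_eq_inter, Finset.univ_inter, Finset.sum_congr rfl (g := h)]
    · rw [add_eq_left]
      refine Finset.sum_eq_zero fun τ hmem => ?_
      simp only [Finset.mem_filter, Finset.mem_univ, true_and, Fintype.mem_piFinset,
        not_forall] at hmem
      obtain ⟨i, hi⟩ := hmem
      rw [Finset.prod_eq_zero (Finset.mem_univ (π.symm i)) (by simp [hi])]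
      simp
    · intro τ hmem
      rw [Fintype.mem_piFinset] at hmem
      rw [Finset.prod_eq_one fun i _ => if_pos (hmem (π i))]
      linear_combination h τ * sign_mul_sign π
  have hdet : ∀ σ, boxForm B σ * h σ = ∑ π : Equiv.Perm (Fin m),
      ((Equiv.Perm.sign π : ℤ) : ℝ) * (∏ i, if σ i ∈ B (π i) then (1 : ℝ) else 0) * h σ := by
    intro σ
    rw [boxForm, Matrix.det_apply', Finset.sum_mul]
    rfl
  rw [Finset.sum_congr rfl fun σ _ => hdet σ, Finset.sum_comm,
    Finset.sum_congr rfl fun π _ => key π]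
  simp [Fintype.card_perm]

lemma sum_boxForm_sq (B : Fin m → Finset V) (hB : ∀ i j, i ≠ j → Disjoint (B i) (B j)) :
    ∑ σ, boxForm B σ * boxForm B σ = (m.factorial : ℝ) * ∏ i, ((B i).card : ℝ) := by
  rw [sum_boxForm_mul B (isSkew_boxForm B),
    Finset.sum_congr rfl fun σ hσ => boxForm_eq_one hB (Fintype.mem_piFinset.1 hσ)]
  simp [Fintype.card_piFinset]

lemma cobdry_boxForm (X : SComplex V) {A : Fin (m + 2) → Finset V}
    (hA : ∀ i j, i ≠ j → Disjoint (A i) (A j)) {τ : Fin (m + 2) → V}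
    (hτ : ∀ i : Fin (m + 1), τ i.succ ∈ A i.succ) :
    X.cobdry (m + 1) (boxForm (A ∘ Fin.castSucc)) τ =
      if τ ∈ Fintype.piFinset A ∧ X.IsCell τ then (-1) ^ (m + 1) else 0 := by
  by_cases hcell : X.IsCell τ
  swap
  · simp [cobdry, hcell]
  have hface : ∀ i : Fin (m + 1), boxForm (A ∘ Fin.castSucc) (τ ∘ i.castSucc.succAbove) = 0 := by
    intro i
    refine boxForm_eq_zero_of_col (Fin.last m) fun j => ?_
    have h1 : (τ ∘ i.castSucc.succAbove) (Fin.last m) = τ (Fin.last m).succ := by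
      simp [Fin.succAbove_of_le_castSucc, Fin.le_last]
    rw [h1]
    exact Finset.disjoint_right.1 (hA _ _ (by simp [Fin.ext_iff]; omega)) (hτ _)
  simp only [cobdry, if_pos hcell, Fin.sum_univ_castSucc, hface, mul_zero,
    Finset.sum_const_zero, zero_add, Fintype.mem_piFinset, Fin.val_last]
  by_cases hmem : ∀ i, τ i ∈ A i
  · rw [if_pos ⟨hmem, hcell⟩, boxForm_eq_one, mul_one]
    · exact fun i j hij => hA _ _ (by simpa using hij)
    · intro i
      simpa using hmem i.castSucc
  · have h0 : τ 0 ∉ A 0 := fun h0 => hmem (Fin.cases h0 hτ)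
    rw [if_neg fun h => hmem h.1, boxForm_eq_zero_of_row 0, mul_zero]
    intro j
    refine Fin.cases ?_ (fun j => ?_) j
    · simpa using h0
    · have h1 : (τ ∘ (Fin.last (m + 1)).succAbove) j.succ = τ j.castSucc.succ := by simp
      rw [h1]
      exact Finset.disjoint_right.1 (hA _ _ (by simp [Fin.ext_iff])) (hτ _)

lemma sum_boxForm_mul_upLap (X : SComplex V) {A : Fin (m + 2) → Finset V}
    (hA : ∀ i j, i ≠ j → Disjoint (A i) (A j)) :
    ∑ σ, boxForm (A ∘ Fin.succ) σ * X.upLap (m + 1) (boxForm (A ∘ Fin.castSucc)) σ =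
      ((m + 1).factorial : ℝ) * ((-1) ^ (m + 1) *
        (((Fintype.piFinset A).filter fun τ => X.IsCell τ).card : ℝ)) := by
  have hskew := isSkew_boxForm (A ∘ Fin.castSucc)
  rw [sum_boxForm_mul _ (hskew.isSkew_upLap X), ← Finset.univ_inter (Fintype.piFinset (_ ∘ _)),
    ← Finset.filter_mem_eq_inter, Finset.sum_filter]
  congr 1
  set F : (Fin (m + 2) → V) → ℝ := fun τ =>
    if τ ∈ Fintype.piFinset A ∧ X.IsCell τ then (-1) ^ (m + 1) else 0
  have h1 : ∀ σ : Fin (m + 1) → V, (if σ ∈ Fintype.piFinset (A ∘ Fin.succ) then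
      X.upLap (m + 1) (boxForm (A ∘ Fin.castSucc)) σ else 0) =
      ∑ v : V, F (Fin.cons v σ) := by
    intro σ
    split_ifs with h
    · rw [upLap, (hskew.isForm_cobdry X).bdry_apply]
      refine Finset.sum_congr rfl fun v _ => cobdry_boxForm X hA fun i => ?_
      simpa using Fintype.mem_piFinset.1 h i
    · refine (Finset.sum_eq_zero fun v _ => if_neg fun hc => h ?_).symm
      exact Fintype.mem_piFinset.2 fun i => by simpa using Fintype.mem_piFinset.1 hc.1 i.succ
  rw [Finset.sum_congr rfl fun σ _ => h1 σ, sum_cons, ← Finset.sum_filter (fun τ => τ ∈ Fintype.piFinset A ∧ X.IsCell τ), Finset.sum_const,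
    ← Finset.filter_filter, Finset.filter_mem_eq_inter, Finset.univ_inter, nsmul_eq_mul, mul_comm]

lemma card_filter_isCell_eq_card_Fcells (X : SComplex V) {A : Fin m → Finset V}
    (hA : ∀ i j, i ≠ j → Disjoint (A i) (A j)) :
    ((Fintype.piFinset A).filter fun τ => X.IsCell τ).card = (X.Fcells A).card := by
  have hinter : ∀ τ ∈ Fintype.piFinset A, ∀ i, tset τ ∩ A i = {τ i} := by
    intro τ hτ i
    rw [Fintype.mem_piFinset] at hτ
    ext w
    simp only [tset, Finset.mem_inter, Finset.mem_image, Finset.mem_univ, true_and,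
      Finset.mem_singleton]
    constructor
    · rintro ⟨⟨j, rfl⟩, hj⟩
      by_contra hne
      exact Finset.disjoint_left.1 (hA i j fun h => hne (h ▸ rfl)) hj (hτ j)
    · rintro rfl
      exact ⟨⟨i, rfl⟩, hτ i⟩
  refine Finset.card_bij (fun τ _ => tset τ) ?_ ?_ ?_
  · intro τ hτ
    obtain ⟨hmem, hinj, hcell⟩ := Finset.mem_filter.1 hτ
    refine Finset.mem_filter.2 ⟨hcell, ?_, fun i => by rw [hinter τ hmem i, card_singleton]⟩
    rw [tset, Finset.card_image_of_injective _ hinj, Finset.card_univ, Fintype.card_fin]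
  · intro τ hτ τ' hτ' heq
    funext i
    have h := hinter τ (Finset.mem_filter.1 hτ).1 i
    rw [heq, hinter τ' (Finset.mem_filter.1 hτ').1 i] at h
    exact (Finset.singleton_injective h).symm
  · intro s hs
    obtain ⟨hcell, hcard, hone⟩ := Finset.mem_filter.1 hs
    choose τ hτ using fun i => Finset.card_eq_one.1 (hone i)
    have hmem : ∀ i, τ i ∈ s ∩ A i := fun i => by rw [hτ i]; exact Finset.mem_singleton_self _
    have hA' : ∀ i, τ i ∈ A i := fun i => (Finset.mem_inter.1 (hmem i)).2
    have hinj := injective_of_forall_mem hA hA'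
    have hset : tset τ = s := by
      refine Finset.eq_of_subset_of_card_le ?_ ?_
      · intro w hw
        obtain ⟨i, -, rfl⟩ := Finset.mem_image.1 hw
        exact (Finset.mem_inter.1 (hmem i)).1
      · rw [tset, Finset.card_image_of_injective _ hinj, hcard, Finset.card_univ,
          Fintype.card_fin]
    exact ⟨τ, Finset.mem_filter.2 ⟨Fintype.mem_piFinset.2 hA', hinj, hset ▸ hcell⟩, hset⟩

lemma card_filter_isCell_fullComplex {A : Fin m → Finset V}
    (hA : ∀ i j, i ≠ j → Disjoint (A i) (A j)) :
    ((Fintype.piFinset A).filter fun τ => (fullComplex V).IsCell τ).card =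
      ∏ i, (A i).card := by
  rw [← Fintype.card_piFinset, Finset.filter_true_of_mem]
  exact fun τ hτ =>
    ⟨injective_of_forall_mem hA (Fintype.mem_piFinset.1 hτ), Finset.mem_univ _⟩

end SComplex

section SymmetricOperators

variable {E : Type*} [NormedAddCommGroup E] [InnerProductSpace ℝ E] [FiniteDimensional ℝ E]

lemma LinearMap.IsSymmetric.norm_apply_le_of_eigenvalues {T : E →ₗ[ℝ] E} (hT : T.IsSymmetric)
    {ρ : ℝ} (hρ : 0 ≤ ρ) (h : ∀ (μ : ℝ) (x : E), x ≠ 0 → T x = μ • x → |μ| ≤ ρ) (x : E) :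
    ‖T x‖ ≤ ρ * ‖x‖ := by
  have heig : ∀ i, |hT.eigenvalues rfl i| ≤ ρ := fun i =>
    h _ _ ((hT.eigenvectorBasis rfl).orthonormal.ne_zero i) (hT.apply_eigenvectorBasis rfl i)
  refine le_of_sq_le_sq ?_ (by positivity)
  rw [mul_pow, ← (hT.eigenvectorBasis rfl).sum_sq_norm_inner_right x,
    ← (hT.eigenvectorBasis rfl).sum_sq_norm_inner_right (T x), Finset.mul_sum]
  refine Finset.sum_le_sum fun i _ => ?_
  rw [← hT, hT.apply_eigenvectorBasis rfl i, inner_smul_left, norm_mul, mul_pow]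
  gcongr
  simpa using heig i

/-- Let `T` and `K` preserve a subspace `W` on which they are symmetric, mapping it into `Z ≤ W`,
with `K` acting on `Z` as multiplication by `n`. If the eigenvalues of `α - T` on `Z` are bounded
by `ρ`, then the bilinear forms of `T` and `(α / n) K` are `ρ`-close on `W`. -/
lemma abs_inner_sub_le_of_eigenvalues {W Z : Submodule ℝ E} (hZW : Z ≤ W) {T K : E →ₗ[ℝ] E}
    (hTZ : ∀ x ∈ W, T x ∈ Z) (hKZ : ∀ x ∈ W, K x ∈ Z)
    (hTs : ∀ x ∈ W, ∀ y ∈ W, inner ℝ (T x) y = inner ℝ x (T y))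
    (hKs : ∀ x ∈ W, ∀ y ∈ W, inner ℝ (K x) y = inner ℝ x (K y))
    {n : ℝ} (hn : n ≠ 0) (hK : ∀ z ∈ Z, K z = n • z) {α ρ : ℝ} (hρ : 0 ≤ ρ)
    (hT : ∀ (μ : ℝ), ∀ z ∈ Z, z ≠ 0 → T z = μ • z → |α - μ| ≤ ρ)
    {x y : E} (hx : x ∈ W) (hy : y ∈ W) :
    |inner ℝ x (T y) - α / n * inner ℝ x (K y)| ≤ ρ * (‖x‖ * ‖y‖) := by
  have hproj : ∀ w, Z.starProjection w ∈ Z := Z.starProjection_apply_mem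
  have hinner : ∀ w, ∀ z ∈ Z, inner ℝ w z = inner ℝ (Z.starProjection w) z := by
    intro w z hz
    have h := Z.sub_starProjection_mem_orthogonal w
    rw [Submodule.mem_orthogonal'] at h
    have h' := h z hz
    rwa [inner_sub_left, sub_eq_zero] at h'
  have hkill : ∀ S : E →ₗ[ℝ] E, (∀ x ∈ W, S x ∈ Z) →
      (∀ x ∈ W, ∀ y ∈ W, inner ℝ (S x) y = inner ℝ x (S y)) →
      inner ℝ x (S y) = inner ℝ (Z.starProjection x) (S (Z.starProjection y)) := by
    intro S hSZ hSs
    have hp := hZW (hproj y)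
    rw [← hSs x hx y hy, real_inner_comm, hinner y _ (hSZ x hx), real_inner_comm,
      hSs x hx _ hp, hinner x _ (hSZ _ hp)]
  have hrestr : ∀ z ∈ Z, (α • LinearMap.id - T : E →ₗ[ℝ] E) z ∈ Z := fun z hz =>
    Z.sub_mem (Z.smul_mem α hz) (hTZ z (hZW hz))
  have hsymm : ((α • LinearMap.id - T).restrict hrestr).IsSymmetric := by
    intro u v
    have h := hTs u (hZW u.2) v (hZW v.2)
    simp [Submodule.coe_inner, inner_sub_left, inner_sub_right, inner_smul_left,
      inner_smul_right, h]
  have hbound := hsymm.norm_apply_le_of_eigenvalues hρ (fun μ z hz hzμ => by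
    have h := congrArg Subtype.val hzμ
    simp only [LinearMap.coe_restrict_apply, LinearMap.sub_apply, LinearMap.smul_apply,
      LinearMap.id_apply, Submodule.coe_smul] at h
    have h1 := hT (α - μ) z z.2 (by simpa using hz) (by rw [sub_smul, ← h]; abel)
    simpa using h1) ⟨_, hproj y⟩
  have hid : inner ℝ x (T y) - α / n * inner ℝ x (K y) =
      - inner ℝ (Z.starProjection x)
        ((α • LinearMap.id - T : E →ₗ[ℝ] E) (Z.starProjection y)) := by
    rw [hkill T hTZ hTs, hkill K hKZ hKs, hK _ (hproj y)]
    simp only [LinearMap.sub_apply, LinearMap.smul_apply, LinearMap.id_apply, inner_sub_right,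
      inner_smul_right]
    field_simp
    ring
  rw [hid, abs_neg]
  calc _ ≤ ‖Z.starProjection x‖ * ‖(α • LinearMap.id - T : E →ₗ[ℝ] E) (Z.starProjection y)‖ :=
        abs_real_inner_le_norm _ _
    _ ≤ ‖x‖ * (ρ * ‖y‖) := by
        gcongr
        · exact Z.norm_starProjection_apply_le x
        · exact hbound.trans (by gcongr; exact Z.norm_starProjection_apply_le y)
    _ = _ := by ring

end SymmetricOperators

namespace SComplex

variable {V : Type} [Fintype V] {m : ℕ}

variable (V m) in
/-- The skew-symmetric functions on tuples, inside Euclidean space. -/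
def skewSubmodule : Submodule ℝ (EuclideanSpace ℝ (Fin m → V)) where
  carrier := {x | IsSkew x.ofLp}
  add_mem' := @fun f g hf hg σ π => by
    simp only [WithLp.ofLp_add, Pi.add_apply, hf σ π, hg σ π]; ring
  zero_mem' := fun σ π => by simp
  smul_mem' := @fun c f hf σ π => by
    simp only [WithLp.ofLp_smul, Pi.smul_apply, smul_eq_mul, hf σ π]; ring

variable (V m) in
/-- The skew-symmetric cycles, inside Euclidean space. -/
def cycleSubmodule : Submodule ℝ (EuclideanSpace ℝ (Fin (m + 1) → V)) where
  carrier := {x | IsSkew x.ofLp ∧ ∀ σ : Fin m → V, ∑ v, x.ofLp (Fin.cons v σ) = 0}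
  add_mem' := fun hf hg => ⟨(skewSubmodule V (m + 1)).add_mem hf.1 hg.1, fun σ => by
    simp [Finset.sum_add_distrib, hf.2 σ, hg.2 σ]⟩
  zero_mem' := ⟨(skewSubmodule V (m + 1)).zero_mem, fun σ => by simp⟩
  smul_mem' := fun c f hf => ⟨(skewSubmodule V (m + 1)).smul_mem c hf.1, fun σ => by
    simp [← Finset.mul_sum, hf.2 σ]⟩

lemma inner_eq_sum (x y : EuclideanSpace ℝ (Fin m → V)) :
    inner ℝ x y = ∑ σ, x.ofLp σ * y.ofLp σ := by
  simp [PiLp.inner_apply, mul_comm]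

variable [DecidableEq V]

/-- The upper Laplacian as an operator on Euclidean space. -/
noncomputable def upLapEuclidean (X : SComplex V) (m : ℕ) :
    EuclideanSpace ℝ (Fin m → V) →ₗ[ℝ] EuclideanSpace ℝ (Fin m → V) :=
  (WithLp.linearEquiv 2 ℝ _).symm.toLinearMap ∘ₗ (X.bdryL m ∘ₗ X.cobdryL m) ∘ₗ
    (WithLp.linearEquiv 2 ℝ _).toLinearMap

lemma ofLp_upLapEuclidean (X : SComplex V) (x : EuclideanSpace ℝ (Fin m → V)) :
    (X.upLapEuclidean m x).ofLp = X.upLap m x.ofLp := rfl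

lemma upLapEuclidean_mem_cycleSubmodule {X : SComplex V} (hX : X.CompleteSkeleton (m + 1))
    {x : EuclideanSpace ℝ (Fin (m + 1) → V)} (hx : x ∈ skewSubmodule V (m + 1)) :
    X.upLapEuclidean (m + 1) x ∈ cycleSubmodule V m := by
  have hx' : IsSkew x.ofLp := hx
  refine ⟨hx'.isSkew_upLap X, fun σ => ?_⟩
  rw [ofLp_upLapEuclidean, ← (hX.isForm (hx'.isSkew_upLap X)).bdry_apply, hX.bdry_upLap hx',
    Pi.zero_apply]

lemma inner_upLapEuclidean_comm (X : SComplex V) {x y : EuclideanSpace ℝ (Fin m → V)}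
    (hx : x ∈ skewSubmodule V m) (hy : y ∈ skewSubmodule V m) :
    inner ℝ (X.upLapEuclidean m x) y = inner ℝ x (X.upLapEuclidean m y) := by
  rw [inner_eq_sum, inner_eq_sum]
  exact (IsSkew.sum_mul_upLap_comm X hx hy).symm

lemma norm_boxForm (B : Fin m → Finset V) (hB : ∀ i j, i ≠ j → Disjoint (B i) (B j)) :
    ‖(WithLp.toLp 2 (boxForm B) : EuclideanSpace ℝ (Fin m → V))‖ =
      √((m.factorial : ℝ) * ∏ i, ((B i).card : ℝ)) := by
  rw [norm_eq_sqrt_real_inner, inner_eq_sum, sum_boxForm_sq B hB]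

lemma abs_inner_upLapEuclidean_sub_le [Nonempty V] {X : SComplex V}
    (hX : X.CompleteSkeleton (m + 1)) {α ρ : ℝ} (hρ0 : 0 ≤ ρ)
    (hρ : ∀ μ ∈ X.specUpLapZ m, |α - μ| ≤ ρ) {x y : EuclideanSpace ℝ (Fin (m + 1) → V)}
    (hx : x ∈ skewSubmodule V (m + 1)) (hy : y ∈ skewSubmodule V (m + 1)) :
    |inner ℝ x (X.upLapEuclidean (m + 1) y) - α / (Fintype.card V : ℝ) *
      inner ℝ x ((fullComplex V).upLapEuclidean (m + 1) y)| ≤ ρ * (‖x‖ * ‖y‖) := by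
  have hKc := completeSkeleton_fullComplex (V := V) (m + 1)
  refine abs_inner_sub_le_of_eigenvalues (W := skewSubmodule V (m + 1))
    (Z := cycleSubmodule V m) (fun z hz => hz.1)
    (fun z hz => upLapEuclidean_mem_cycleSubmodule hX hz)
    (fun z hz => upLapEuclidean_mem_cycleSubmodule hKc hz)
    (fun z hz w hw => inner_upLapEuclidean_comm X hz hw)
    (fun z hz w hw => inner_upLapEuclidean_comm (fullComplex V) hz hw)
    (by positivity) (fun z hz => ?_) hρ0 (fun μ z hz hz0 hμ => ?_) hx hy
  · ext σ
    exact upLap_fullComplex_of_cycle hz.1 hz.2 σ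
  · have hform := hX.isForm hz.1
    refine hρ μ ⟨z.ofLp, hform, ?_, by simpa using hz0, congrArg WithLp.ofLp hμ⟩
    funext σ
    rw [hform.bdry_apply, hz.2 σ, Pi.zero_apply]

/-- The discrepancy bound obtained by omitting the first and the last set. -/
lemma abs_card_Fcells_sub_le [Nonempty V] {X : SComplex V} (hX : X.CompleteSkeleton (m + 1))
    {α ρ : ℝ} (hρ0 : 0 ≤ ρ) (hρ : ∀ μ ∈ X.specUpLapZ m, |α - μ| ≤ ρ)
    {A : Fin (m + 2) → Finset V} (hA : ∀ i j, i ≠ j → Disjoint (A i) (A j)) :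
    |((X.Fcells A).card : ℝ) - α * (∏ i, ((A i).card : ℝ)) / (Fintype.card V : ℝ)| ≤
      ρ * √((∏ i : Fin (m + 1), ((A i.succ).card : ℝ)) *
        ∏ i : Fin (m + 1), ((A i.castSucc).card : ℝ)) := by
  have key := abs_inner_upLapEuclidean_sub_le hX hρ0 hρ
    (x := WithLp.toLp 2 (boxForm (A ∘ Fin.succ)))
    (y := WithLp.toLp 2 (boxForm (A ∘ Fin.castSucc)))
    (isSkew_boxForm (A ∘ Fin.succ)) (isSkew_boxForm (A ∘ Fin.castSucc))
  have hinner : ∀ Y : SComplex V, inner ℝ (WithLp.toLp 2 (boxForm (A ∘ Fin.succ)))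
      (Y.upLapEuclidean (m + 1) (WithLp.toLp 2 (boxForm (A ∘ Fin.castSucc)))) =
      ((m + 1).factorial : ℝ) * ((-1) ^ (m + 1) *
        (((Fintype.piFinset A).filter fun τ => Y.IsCell τ).card : ℝ)) := by
    intro Y
    rw [inner_eq_sum]
    exact sum_boxForm_mul_upLap Y hA
  have hsucc : ∀ i j : Fin (m + 1), i ≠ j → Disjoint ((A ∘ Fin.succ) i) ((A ∘ Fin.succ) j) :=
    fun i j hij => hA _ _ ((Fin.succ_injective _).ne hij)
  have hcast : ∀ i j : Fin (m + 1), i ≠ j →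
      Disjoint ((A ∘ Fin.castSucc) i) ((A ∘ Fin.castSucc) j) :=
    fun i j hij => hA _ _ ((Fin.castSucc_injective _).ne hij)
  have hfac : (0 : ℝ) < ((m + 1).factorial : ℝ) := Nat.cast_pos.2 (Nat.factorial_pos _)
  rw [hinner, hinner, card_filter_isCell_eq_card_Fcells X hA, card_filter_isCell_fullComplex hA,
    norm_boxForm _ hsucc, norm_boxForm _ hcast, Real.sqrt_mul hfac.le, Real.sqrt_mul hfac.le,
    mul_mul_mul_comm, Real.mul_self_sqrt hfac.le,
    ← Real.sqrt_mul (Finset.prod_nonneg fun _ _ => Nat.cast_nonneg _), Nat.cast_prod] at key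
  generalize ((m + 1).factorial : ℝ) = c at key hfac
  have hfactor : c * ((-1) ^ (m + 1) * ((X.Fcells A).card : ℝ)) -
      α / (Fintype.card V : ℝ) * (c * ((-1) ^ (m + 1) * ∏ i, ((A i).card : ℝ))) =
      c * (-1) ^ (m + 1) *
        (((X.Fcells A).card : ℝ) - α * (∏ i, ((A i).card : ℝ)) / (Fintype.card V : ℝ)) := by
    ring
  rw [hfactor, abs_mul, abs_mul, abs_pow, abs_neg, abs_one, one_pow, mul_one,
    abs_of_pos hfac, mul_left_comm] at key
  exact le_of_mul_le_mul_left key hfac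

lemma Fcells_comp_equiv (X : SComplex V) (A : Fin m → Finset V) (e : Equiv.Perm (Fin m)) :
    X.Fcells (A ∘ e) = X.Fcells A := by
  refine Finset.filter_congr fun s _ => and_congr_right fun _ => ?_
  exact e.forall_congr_right (q := fun i => (s ∩ A i).card = 1)

end SComplex

/-- If `L` is at most `ρ` times the geometric mean of the products omitting cyclically
consecutive factors, then `L` is at most `ρ` times the matching power of the full product. -/
lemma le_mul_prod_rpow_of_cyclic {d : ℕ} {a : Fin (d + 2) → ℝ} (ha : ∀ i, 0 < a i) {L ρ : ℝ}
    (hL : 0 ≤ L) (hρ : 0 ≤ ρ)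
    (h : ∀ k, L ≤ ρ * √((∏ i : Fin (d + 1), a (i.succ + k)) *
      ∏ i : Fin (d + 1), a (i.castSucc + k))) :
    L ≤ ρ * (∏ i, a i) ^ (((d : ℝ) + 1) / ((d : ℝ) + 2)) := by
  have hP : 0 < ∏ i, a i := Finset.prod_pos fun i _ => ha i
  have hrot : ∀ k, ∏ i, a (i + k) = ∏ i, a i := fun k => Equiv.prod_comp (Equiv.addRight k) a
  have hsq : ∀ k, L ^ 2 * (a k * a (Fin.last (d + 1) + k)) ≤ (ρ * ∏ i, a i) ^ 2 := by
    intro k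
    have h1 := hrot k
    have h2 := hrot k
    rw [Fin.prod_univ_succ, zero_add] at h1
    rw [Fin.prod_univ_castSucc] at h2
    have h3 := pow_le_pow_left₀ hL (h k) 2
    rw [mul_pow, Real.sq_sqrt (mul_nonneg (Finset.prod_nonneg fun i _ => (ha _).le)
      (Finset.prod_nonneg fun i _ => (ha _).le))] at h3
    have h4 := mul_le_mul_of_nonneg_right h3
      (mul_pos (ha k) (ha (Fin.last (d + 1) + k))).le
    refine h4.trans_eq ?_
    rw [mul_pow, sq (∏ i, a i)]
    nth_rewrite 1 [← h1]
    rw [← h2]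
    ring
  have hprod := Finset.prod_le_prod (s := Finset.univ)
    (fun k _ => mul_nonneg (sq_nonneg L) (mul_pos (ha k) (ha (Fin.last (d + 1) + k))).le)
    fun k _ => hsq k
  have hrot' : ∏ k, a (Fin.last (d + 1) + k) = ∏ i, a i :=
    Equiv.prod_comp (Equiv.addLeft (Fin.last (d + 1))) a
  simp only [Finset.prod_mul_distrib, Finset.prod_const, Finset.card_univ, Fintype.card_fin,
    hrot'] at hprod
  have hpow : L ^ (d + 2) * ∏ i, a i ≤ (ρ * ∏ i, a i) ^ (d + 2) := by
    refine le_of_sq_le_sq ?_ (by positivity)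
    calc _ = (L ^ 2) ^ (d + 2) * ((∏ i, a i) * ∏ i, a i) := by ring
      _ ≤ _ := hprod
      _ = _ := by ring
  have hpow' : L ^ (d + 2) ≤ ρ ^ (d + 2) * (∏ i, a i) ^ (d + 1) := by
    refine le_of_mul_le_mul_right (hpow.trans_eq ?_) hP
    ring
  refine le_of_pow_le_pow_left₀ (n := d + 2) (by omega) (by positivity) (hpow'.trans_eq ?_)
  rw [mul_pow, ← Real.rpow_mul_natCast hP.le, ← Real.rpow_natCast _ (d + 1)]
  congr 2
  push_cast
  field_simp

open SComplex in
/-- **Mixing Lemma** (Theorem 1.5 / Section 4.3): for a `(d+1)`-dimensional complex with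
complete skeleton, `α : ℝ`, and `ρ_α` the maximal absolute value of an eigenvalue of
`α·I - Δ⁺` restricted to `Z`, for all pairwise disjoint vertex sets `A 0, …, A (d+1)`:
`| |F(A₀,…)| - α·∏|Aᵢ|/n | ≤ ρ_α · (∏|Aᵢ|)^{(d+1)/(d+2)}`. -/
theorem mixing_lemma (V : Type) [Fintype V] [DecidableEq V] (d : ℕ)
    (X : SComplex V) (hdim : X.Dim (d + 1)) (hskel : X.CompleteSkeleton (d + 1))
    (α ρ : ℝ)
    (hρ : IsGreatest {r : ℝ | ∃ μ ∈ X.specUpLapZ d, r = |α - μ|} ρ)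
    (A : Fin (d + 2) → Finset V) (hA : ∀ i j, i ≠ j → Disjoint (A i) (A j)) :
    |((X.Fcells A).card : ℝ) - α * (∏ i, ((A i).card : ℝ)) / (Fintype.card V : ℝ)| ≤
      ρ * (∏ i, ((A i).card : ℝ)) ^ (((d : ℝ) + 1) / ((d : ℝ) + 2)) := by
  obtain ⟨s, -, hs⟩ := hdim.2
  have hV : Nonempty V := by
    obtain ⟨v, -⟩ := Finset.card_pos.1 (by omega : 0 < s.card)
    exact ⟨v⟩
  have hρ0 : 0 ≤ ρ := by
    obtain ⟨μ, -, rfl⟩ := hρ.1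
    exact abs_nonneg _
  by_cases hpos : ∀ i, (0 : ℝ) < (A i).card
  · refine le_mul_prod_rpow_of_cyclic hpos (abs_nonneg _) hρ0 fun k => ?_
    have h := abs_card_Fcells_sub_le hskel hρ0 (fun μ hμ => hρ.2 ⟨μ, hμ, rfl⟩)
      (A := A ∘ Equiv.addRight k) fun i j hij => hA _ _ (by simpa using hij)
    rw [Fcells_comp_equiv] at h
    simp only [Function.comp_apply] at h
    rw [Equiv.prod_comp (Equiv.addRight k) fun i => ((A i).card : ℝ)] at h
    exact h
  · push Not at hpos
    obtain ⟨i, hi⟩ := hpos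
    have hi0 : (A i).card = 0 := by exact_mod_cast le_antisymm hi (Nat.cast_nonneg _)
    have hF : X.Fcells A = ∅ := by
      refine Finset.filter_false_of_mem fun t _ h => ?_
      have h1 := h.2 i
      rw [Finset.card_eq_zero.1 hi0, Finset.inter_empty] at h1
      simp at h1
    rw [hF, Finset.prod_eq_zero (Finset.mem_univ i) (by simp [hi0])]
    simp only [Finset.card_empty, Nat.cast_zero, mul_zero, zero_div, sub_zero, abs_zero]
    positivity
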